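/- For every second-order sentence ψ with h(ψ) < ∞ there exists a second-order sentence φ with h(ψ) < h(φ) < ∞; that is, the Hanf values of second-order sentences with bounded spectrum are cofinal beyond any one of them. -/

import Mathlib

open FirstOrder Cardinal

namespace Hanf

/-- Formulas of (extensions of) infinitary first-order logic over a vocabulary `L`:
first-order logic with equality, infinitary conjunctions, monadic second-order
(set) variables, binary relation variables, and the quantifiers
`wo` (well-ordering), `∃^c` (countable set), `aa` (stationary), `∃R` (second order),
and `Q^{cf}_{ℵ₀}` (countable cofinality). -/
inductive Fml (L : FirstOrder.Language.{0,0}) : Type 1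
  | rel : {n : ℕ} → L.Relations n → (Fin n → L.Term ℕ) → Fml L
  | eq : L.Term ℕ → L.Term ℕ → Fml L
  | mem : ℕ → L.Term ℕ → Fml L
  | rmem : ℕ → L.Term ℕ → L.Term ℕ → Fml L
  | not : Fml L → Fml L
  | conj : (ι : Type) → (ι → Fml L) → Fml L
  | all : ℕ → Fml L → Fml L
  | qWo : ℕ → ℕ → Fml L → Fml L
  | qC : ℕ → Fml L → Fml L
  | qAA : ℕ → Fml L → Fml L
  | qII : ℕ → Fml L → Fml L
  | qCf : ℕ → ℕ → Fml L → Fml L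

variable {L : FirstOrder.Language.{0,0}}

/-- A family of countable subsets of `M` which is closed under unions of countable
increasing chains and cofinal (under `⊆`) in the countable subsets of `M`. -/
def IsClubFam {M : Type} (C : Set (Set M)) : Prop :=
  (∀ S ∈ C, S.Countable) ∧
  (∀ f : ℕ → Set M, (∀ n, f n ∈ C) → Monotone f → (⋃ n, f n) ∈ C) ∧
  (∀ S : Set M, S.Countable → ∃ T ∈ C, S ⊆ T)

/-- The field of a binary relation. -/
def fieldOf {M : Type} (r : M → M → Prop) : Set M :=
  {a | (∃ b, r a b) ∨ ∃ b, r b a}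

/-- `r` well-orders its field. -/
def WellOrdersField {M : Type} (r : M → M → Prop) : Prop :=
  IsWellOrder (fieldOf r) (fun a b => r a.1 b.1)

/-- `r` is a linear order of its field, of cofinality `ℵ₀`:
it is irreflexive, transitive and trichotomous on its field, some countable
sequence is cofinal in it, and it has no maximal element. -/
def LinearOrdersFieldCofOmega {M : Type} (r : M → M → Prop) : Prop :=
  (∀ a ∈ fieldOf r, ¬ r a a) ∧
  (∀ a ∈ fieldOf r, ∀ b ∈ fieldOf r, ∀ c ∈ fieldOf r, r a b → r b c → r a c) ∧
  (∀ a ∈ fieldOf r, ∀ b ∈ fieldOf r, a ≠ b → r a b ∨ r b a) ∧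
  (∃ c : ℕ → M, (∀ n, c n ∈ fieldOf r) ∧ ∀ a ∈ fieldOf r, ∃ n, a = c n ∨ r a (c n)) ∧
  (∀ a ∈ fieldOf r, ∃ b ∈ fieldOf r, r a b)

/-- Satisfaction, relative to assignments of the first-order variables,
the monadic (set) variables and the binary relation variables. -/
def Eval {M : Type} [L.Structure M] :
    Fml L → (ℕ → M) → (ℕ → Set M) → (ℕ → M → M → Prop) → Prop
  | .rel R ts, va, _, _ => Language.Structure.RelMap R (fun i => (ts i).realize va)
  | .eq t₁ t₂, va, _, _ => t₁.realize va = t₂.realize va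
  | .mem X t, va, vs, _ => t.realize va ∈ vs X
  | .rmem R t₁ t₂, va, _, vr => vr R (t₁.realize va) (t₂.realize va)
  | .not φ, va, vs, vr => ¬ Eval φ va vs vr
  | .conj _ f, va, vs, vr => ∀ i, Eval (f i) va vs vr
  | .all x φ, va, vs, vr => ∀ a, Eval φ (Function.update va x a) vs vr
  | .qWo x y φ, va, vs, vr =>
      WellOrdersField (fun a b =>
        Eval φ (Function.update (Function.update va x a) y b) vs vr)
  | .qC X φ, va, vs, vr => ∃ S : Set M, S.Countable ∧ Eval φ va (Function.update vs X S) vr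
  | .qAA X φ, va, vs, vr =>
      ∃ C : Set (Set M), IsClubFam C ∧ ∀ S ∈ C, Eval φ va (Function.update vs X S) vr
  | .qII R φ, va, vs, vr => ∃ r : M → M → Prop, Eval φ va vs (Function.update vr R r)
  | .qCf x y φ, va, vs, vr =>
      LinearOrdersFieldCofOmega (fun a b =>
        Eval φ (Function.update (Function.update va x a) y b) vs vr)

/-- The variables of a term. -/
def tvars : L.Term ℕ → Set ℕ
  | .var i => {i}
  | .func _ ts => ⋃ i, tvars (ts i)

/-- Free first-order variables. -/
def fv : Fml L → Set ℕ
  | .rel _ ts => ⋃ i, tvars (ts i)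
  | .eq t₁ t₂ => tvars t₁ ∪ tvars t₂
  | .mem _ t => tvars t
  | .rmem _ t₁ t₂ => tvars t₁ ∪ tvars t₂
  | .not φ => fv φ
  | .conj _ f => ⋃ i, fv (f i)
  | .all x φ => fv φ \ {x}
  | .qWo x y φ => fv φ \ {x, y}
  | .qC _ φ => fv φ
  | .qAA _ φ => fv φ
  | .qII _ φ => fv φ
  | .qCf x y φ => fv φ \ {x, y}

/-- Free monadic (set) variables. -/
def sv : Fml L → Set ℕ
  | .rel _ _ => ∅
  | .eq _ _ => ∅
  | .mem X _ => {X}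
  | .rmem _ _ _ => ∅
  | .not φ => sv φ
  | .conj _ f => ⋃ i, sv (f i)
  | .all _ φ => sv φ
  | .qWo _ _ φ => sv φ
  | .qC X φ => sv φ \ {X}
  | .qAA X φ => sv φ \ {X}
  | .qII _ φ => sv φ
  | .qCf _ _ φ => sv φ

/-- Free binary relation variables. -/
def rv : Fml L → Set ℕ
  | .rel _ _ => ∅
  | .eq _ _ => ∅
  | .mem _ _ => ∅
  | .rmem R _ _ => {R}
  | .not φ => rv φ
  | .conj _ f => ⋃ i, rv (f i)
  | .all _ φ => rv φ
  | .qWo _ _ φ => rv φ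
  | .qC _ φ => rv φ
  | .qAA _ φ => rv φ
  | .qII R φ => rv φ \ {R}
  | .qCf _ _ φ => rv φ

/-- A sentence: no free variables of any kind. -/
def IsSentence (φ : Fml L) : Prop := fv φ = ∅ ∧ sv φ = ∅ ∧ rv φ = ∅

/-- Which extra quantifiers a logic allows, and the bound on the size
of its conjunctions (`conjBound = ℵ₀` gives finitary logic). -/
structure Allowed where
  wo : Prop
  c : Prop
  aa : Prop
  ii : Prop
  cf : Prop
  conjBound : Cardinal.{0}

/-- The formula lies in the logic described by `A`. -/
def Ok (A : Allowed) : Fml L → Prop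
  | .rel _ _ => True
  | .eq _ _ => True
  | .mem _ _ => True
  | .rmem _ _ _ => True
  | .not φ => Ok A φ
  | .conj ι f => #ι < A.conjBound ∧ ∀ i, Ok A (f i)
  | .all _ φ => Ok A φ
  | .qWo _ _ φ => A.wo ∧ Ok A φ
  | .qC _ φ => A.c ∧ Ok A φ
  | .qAA _ φ => A.aa ∧ Ok A φ
  | .qII _ φ => A.ii ∧ Ok A φ
  | .qCf _ _ φ => A.cf ∧ Ok A φ

/-- `M ⊨ φ` (for sentences this does not depend on the assignments). -/
def Sat (M : Type) [L.Structure M] (φ : Fml L) : Prop :=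
  ∀ (va : ℕ → M) (vs : ℕ → Set M) (vr : ℕ → M → M → Prop), Eval φ va vs vr

/-- `h(φ) < ∞`: `φ` has no models of arbitrarily large cardinality. -/
def BddSpec (φ : Fml L) : Prop :=
  ∃ κ : Cardinal, ∀ (M : Type) (S : L.Structure M), @Sat L M S φ → #M < κ

/-- The Hanf value `h(φ) = sup {|M|⁺ : M ⊨ φ}`. -/
noncomputable def hanfVal (φ : Fml L) : Cardinal :=
  sSup {c | ∃ (M : Type) (S : L.Structure M), @Sat L M S φ ∧ c = Order.succ #M}

/-- The Hanf number of the logic `A`: the supremum of `h(φ)` over all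
sentences `φ` of the logic (in any vocabulary) with `h(φ) < ∞`. -/
noncomputable def hanfNum (A : Allowed) : Cardinal :=
  sSup {c | ∃ (L : FirstOrder.Language.{0,0}) (φ : Fml L),
    IsSentence φ ∧ Ok A φ ∧ BddSpec φ ∧ c = hanfVal φ}

/-- The Hanf number of the logic `A` computed over vocabularies of cardinality `≤ χ`. -/
noncomputable def hanfNumVocab (A : Allowed) (χ : Cardinal) : Cardinal :=
  sSup {c | ∃ (L : FirstOrder.Language.{0,0}), L.card ≤ χ ∧ ∃ φ : Fml L,
    IsSentence φ ∧ Ok A φ ∧ BddSpec φ ∧ c = hanfVal φ}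

/-- `L^{wo}_{ω,ω}`. -/
def Lwo : Allowed := ⟨True, False, False, False, False, ℵ₀⟩
/-- `L^c_{ω,ω}`. -/
def Lc : Allowed := ⟨False, True, False, False, False, ℵ₀⟩
/-- `L^{aa}_{ω,ω}`. -/
def Laa : Allowed := ⟨False, False, True, False, False, ℵ₀⟩
/-- `L^{II}_{ω,ω}`. -/
def LII : Allowed := ⟨False, False, False, True, False, ℵ₀⟩
/-- `L_{ω,ω}(Q^{cf}_{ℵ₀})`. -/
def Lcf : Allowed := ⟨False, False, False, False, True, ℵ₀⟩
/-- `L^{wo}_{κ,ω}`: conjunctions of `< κ` formulas. -/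
def LwoInf (κ : Cardinal) : Allowed := ⟨True, False, False, False, False, κ⟩
/-- `L^c_{κ,ω}`. -/
def LcInf (κ : Cardinal) : Allowed := ⟨False, True, False, False, False, κ⟩
/-- `L^{II}_{κ,ω}`. -/
def LIIInf (κ : Cardinal) : Allowed := ⟨False, False, False, True, False, κ⟩


/-- Function symbols of the expanded vocabulary: an extra parameter argument for each old symbol,
plus two binary functions. -/
inductive PF (L : FirstOrder.Language.{0,0}) : ℕ → Type
  | lift : {n : ℕ} → L.Functions n → PF L (n+1)
  | r : PF L 2
  | g : PF L 2

/-- Relation symbols of the expanded vocabulary. -/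
inductive PR (L : FirstOrder.Language.{0,0}) : ℕ → Type
  | lift : {n : ℕ} → L.Relations n → PR L (n+1)
  | lt : PR L 2

/-- The expanded vocabulary. -/
abbrev PL (L : FirstOrder.Language.{0,0}) : FirstOrder.Language.{0,0} := ⟨PF L, PR L⟩

section
/-- `r(a,b)` -/
def tR (a b : (PL L).Term ℕ) : (PL L).Term ℕ := .func (l := 2) (PF.r : PF L 2) ![a, b]
/-- `g(a,b)` -/
def tG (a b : (PL L).Term ℕ) : (PL L).Term ℕ := .func (l := 2) (PF.g : PF L 2) ![a, b]

/-- Translation of terms, parameter is variable `0`. -/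
def trT : L.Term ℕ → (PL L).Term ℕ
  | .var i => tR (.var 0) (.var (i+1))
  | .func (l := n) f ts => tR (.var 0)
      (.func (l := n+1) (PF.lift f : PF L (n+1)) (Fin.cons (.var 0) fun i => trT (ts i)))

/-- Translation of formulas. -/
def tr : Fml L → Fml (PL L)
  | .rel (n := n) R ts =>
      .rel (n := n+1) (PR.lift R : PR L (n+1)) (Fin.cons (.var 0) fun i => trT (ts i))
  | .eq t₁ t₂ => .eq (trT t₁) (trT t₂)
  | .mem X t => .mem X (trT t)
  | .rmem R t₁ t₂ => .rmem R (trT t₁) (trT t₂)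
  | .not φ => .not (tr φ)
  | .conj ι f => .conj ι (fun i => tr (f i))
  | .all x φ => .all (x+1) (tr φ)
  | .qWo x y φ => .qWo (x+1) (y+1) (tr φ)
  | .qC X φ => .qC X (tr φ)
  | .qAA X φ => .qAA X (tr φ)
  | .qII R φ => .qII R (tr φ)
  | .qCf x y φ => .qCf (x+1) (y+1) (tr φ)

theorem tvars_tR (a b : (PL L).Term ℕ) : tvars (tR a b) = tvars a ∪ tvars b := by
  ext x; simp [tR, tvars, Fin.exists_fin_two]

theorem tvars_tG (a b : (PL L).Term ℕ) : tvars (tG a b) = tvars a ∪ tvars b := by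
  ext x; simp [tG, tvars, Fin.exists_fin_two]

theorem tvars_trT (t : L.Term ℕ) : ∀ x, x + 1 ∈ tvars (trT t) → x ∈ tvars t := by
  induction t with
  | var i => intro x hx; simpa [trT, tvars_tR, tvars] using hx
  | func f ts ih =>
    intro x hx
    simp only [trT, tvars_tR, tvars, Set.mem_union, Set.mem_iUnion, Fin.exists_fin_succ] at hx ⊢
    rcases hx with hx | hx | ⟨i, hx⟩
    · simp at hx
    · simp [tvars] at hx
    · exact ⟨i, ih i x hx⟩

theorem fv_tr (φ : Fml L) : ∀ x, x + 1 ∈ fv (tr φ) → x ∈ fv φ := by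
  induction φ with
  | rel R ts =>
    intro x hx
    simp only [tr, fv, Set.mem_iUnion, Fin.exists_fin_succ] at hx ⊢
    rcases hx with hx | ⟨i, hx⟩
    · simp [tvars] at hx
    · exact ⟨i, tvars_trT _ x hx⟩
  | eq t₁ t₂ => intro x hx; exact hx.imp (tvars_trT _ x) (tvars_trT _ x)
  | mem X t => intro x hx; exact tvars_trT _ x hx
  | rmem R t₁ t₂ => intro x hx; exact hx.imp (tvars_trT _ x) (tvars_trT _ x)
  | not φ ih => exact ih
  | conj ι f ih =>
    intro x hx
    simp only [tr, fv, Set.mem_iUnion] at hx ⊢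
    obtain ⟨i, hi⟩ := hx
    exact ⟨i, ih i x hi⟩
  | all y φ ih => intro x hx; exact ⟨ih x hx.1, by simpa using hx.2⟩
  | qWo y z φ ih => intro x hx; exact ⟨ih x hx.1, by simpa using hx.2⟩
  | qC _ φ ih => exact ih
  | qAA _ φ ih => exact ih
  | qII _ φ ih => exact ih
  | qCf y z φ ih => intro x hx; exact ⟨ih x hx.1, by simpa using hx.2⟩

theorem sv_tr (φ : Fml L) : sv (tr φ) = sv φ := by
  induction φ <;> simp_all [tr, sv]

theorem rv_tr (φ : Fml L) : rv (tr φ) = rv φ := by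
  induction φ <;> simp_all [tr, rv]

theorem ok_tr (A : Allowed) (φ : Fml L) : Ok A (tr φ) ↔ Ok A φ := by
  induction φ <;> simp_all [tr, Ok]

/-- Compatibility of an `L`-structure `M` with the slice at `p` of a `PL L`-structure `N`. -/
structure Slice (N M : Type) [(PL L).Structure N] [L.Structure M] (p : N)
    (ρ : N → M) (e : M → N) : Prop where
  surj : Function.Surjective ρ
  inj : Function.Injective e
  r : ∀ x, Language.Structure.funMap (L := PL L) (n := 2) (PF.r : PF L 2) ![p, x] = e (ρ x)
  fn : ∀ {n} (f : L.Functions n) (xs : Fin n → M), Language.Structure.funMap f xs =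
    ρ (Language.Structure.funMap (L := PL L) (n := n+1) (PF.lift f : PF L (n+1))
      (Fin.cons p (e ∘ xs) : Fin (n+1) → N))
  rl : ∀ {n} (R : L.Relations n) (xs : Fin n → M), Language.Structure.RelMap R xs ↔
    Language.Structure.RelMap (L := PL L) (n := n+1) (PR.lift R : PR L (n+1))
      (Fin.cons p (e ∘ xs) : Fin (n+1) → N)

theorem realize_tR {N : Type} [(PL L).Structure N] (a b : (PL L).Term ℕ) (v : ℕ → N) :
    (tR a b).realize v = Language.Structure.funMap (L := PL L) (n := 2) (PF.r : PF L 2)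
      ![a.realize v, b.realize v] := by
  simp only [tR, Language.Term.realize_func]
  congr 1; funext i; fin_cases i <;> rfl

theorem realize_tG {N : Type} [(PL L).Structure N] (a b : (PL L).Term ℕ) (v : ℕ → N) :
    (tG a b).realize v = Language.Structure.funMap (L := PL L) (n := 2) (PF.g : PF L 2)
      ![a.realize v, b.realize v] := by
  simp only [tG, Language.Term.realize_func]
  congr 1; funext i; fin_cases i <;> rfl

theorem cons_realize {N : Type} [(PL L).Structure N] {n : ℕ} (a : (PL L).Term ℕ)
    (ts : Fin n → (PL L).Term ℕ) (v : ℕ → N) :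
    (fun i => ((Fin.cons a ts : Fin (n+1) → (PL L).Term ℕ) i).realize v) =
      (Fin.cons (a.realize v) (fun i => (ts i).realize v) : Fin (n+1) → N) := by
  funext i
  refine Fin.cases ?_ (fun j => ?_) i <;> simp

variable {N M : Type} [(PL L).Structure N] [L.Structure M] {p : N} {ρ : N → M} {e : M → N}

theorem realize_trT (h : Slice (L := L) N M p ρ e) (t : L.Term ℕ) (va : ℕ → N) (h0 : va 0 = p) :
    (trT t).realize va = e (t.realize fun i => ρ (va (i+1))) := by
  induction t with
  | var i => simp [trT, realize_tR, h0, h.r]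
  | func f ts ih =>
    simp only [trT, realize_tR, Language.Term.realize_func]
    rw [cons_realize]
    simp only [Language.Term.realize_var, h0, h.r, h.fn, ih]
    rfl

theorem eval_tr (h : Slice (L := L) N M p ρ e) (φ : Fml L) (hok : Ok LII φ) :
    ∀ (va : ℕ → N) (vs : ℕ → Set N) (vr : ℕ → N → N → Prop), va 0 = p →
    (Eval (tr φ) va vs vr ↔ Eval φ (fun i => ρ (va (i+1))) (fun X => Set.preimage e (vs X))
      (fun R a b => vr R (e a) (e b))) := by
  induction φ with
  | rel R ts =>
    intro va vs vr h0
    simp only [tr, Eval]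
    rw [cons_realize, h.rl]
    simp only [Language.Term.realize_var, h0, realize_trT h _ va h0]
    rfl
  | eq t₁ t₂ =>
    intro va vs vr h0
    simp only [tr, Eval, realize_trT h _ va h0, h.inj.eq_iff]
  | mem X t =>
    intro va vs vr h0
    simp only [tr, Eval, realize_trT h _ va h0, Set.mem_preimage]
  | rmem R t₁ t₂ =>
    intro va vs vr h0
    simp only [tr, Eval, realize_trT h _ va h0]
  | not φ ih =>
    intro va vs vr h0
    simp only [tr, Eval, ih hok va vs vr h0]
  | conj ι f ih =>
    intro va vs vr h0
    simp only [tr, Eval, ih _ (hok.2 _) va vs vr h0]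
  | all x φ ih =>
    intro va vs vr h0
    simp only [tr, Eval]
    rw [← h.surj.forall (p := fun a => Eval φ (Function.update (fun i => ρ (va (i+1))) x a) _ _) |>.symm]
    refine forall_congr' fun a => ?_
    rw [ih hok _ _ _ (by simpa using h0)]
    have : (fun i => ρ (Function.update va (x+1) a (i+1)))
        = Function.update (fun i => ρ (va (i+1))) x (ρ a) := by
      funext i
      by_cases hi : i = x
      · subst hi; simp
      · simp [hi]
    rw [this]
  | qII R φ ih =>
    intro va vs vr h0
    simp only [tr, Eval]
    have key : ∀ r : N → N → Prop,
        (fun S a b => (Function.update vr R r) S (e a) (e b)) =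
        Function.update (fun S a b => vr S (e a) (e b)) R (fun a b => r (e a) (e b)) := by
      intro r
      funext S
      by_cases hS : S = R
      · subst hS; simp
      · simp [hS]
    constructor
    · rintro ⟨r, hr⟩
      rw [ih hok.2 _ _ _ h0, key] at hr
      exact ⟨_, hr⟩
    · rintro ⟨r, hr⟩
      refine ⟨fun a b => ∃ c d, e c = a ∧ e d = b ∧ r c d, ?_⟩
      rw [ih hok.2 _ _ _ h0, key]
      convert hr using 2
      funext a b
      refine propext ⟨?_, fun hab => ⟨a, b, rfl, rfl, hab⟩⟩
      rintro ⟨c, d, hc, hd, hcd⟩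
      rwa [h.inj hc, h.inj hd] at hcd
  | qWo _ _ φ ih => exact hok.1.elim
  | qC _ φ ih => exact hok.1.elim
  | qAA _ φ ih => exact hok.1.elim
  | qCf _ _ φ ih => exact hok.1.elim

/-- `x < y` -/
def fLt (x y : ℕ) : Fml (PL L) := .rel (n := 2) (PR.lt : PR L 2) ![.var x, .var y]

/-- conjunction -/
def fAnd (a b : Fml L) : Fml L := .conj Bool (fun i => cond i a b)
/-- implication -/
def fImp (a b : Fml L) : Fml L := .not (fAnd a (.not b))

/-- The order relation. -/
def LTrel (N : Type) [(PL L).Structure N] (x y : N) : Prop :=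
  Language.Structure.RelMap (L := PL L) (n := 2) (PR.lt : PR L 2) ![x, y]
/-- The function r. -/
def rr (N : Type) [(PL L).Structure N] (x y : N) : N :=
  Language.Structure.funMap (L := PL L) (n := 2) (PF.r : PF L 2) ![x, y]
/-- The function g. -/
def gg (N : Type) [(PL L).Structure N] (x y : N) : N :=
  Language.Structure.funMap (L := PL L) (n := 2) (PF.g : PF L 2) ![x, y]

theorem eval_fAnd (a b : Fml L) (va : ℕ → M) (vs) (vr) :
    Eval (fAnd a b) va vs vr ↔ Eval a va vs vr ∧ Eval b va vs vr := by
  simp [fAnd, Eval, and_comm]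

theorem eval_fImp (a b : Fml L) (va : ℕ → M) (vs) (vr) :
    Eval (fImp a b) va vs vr ↔ (Eval a va vs vr → Eval b va vs vr) := by
  simp [fImp, Eval, eval_fAnd]

theorem eval_fLt (x y : ℕ) (va : ℕ → N) (vs) (vr) :
    Eval (fLt (L := L) x y) va vs vr ↔ LTrel (L := L) N (va x) (va y) := by
  simp only [fLt, Eval, LTrel]
  apply iff_of_eq
  congr 1
  funext i; fin_cases i <;> rfl

/-- totality: `x ≠ y → ¬ x < y → y < x` -/
def ax1 : Fml (PL L) := .all 0 (.all 1 (fImp (.not (.eq (.var 0) (.var 1)))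
  (fImp (.not (fLt 0 1)) (fLt 1 0))))
/-- injectivity -/
def ax2 : Fml (PL L) := .all 0 (.all 1 (.all 2 (fImp (fLt 1 0) (fImp (fLt 2 0)
  (fImp (.eq (tR (.var 0) (tG (.var 0) (.var 1))) (tR (.var 0) (tG (.var 0) (.var 2))))
    (.eq (.var 1) (.var 2)))))))
/-- slices are models -/
def ax3 (ψ : Fml L) : Fml (PL L) := .all 0 (fImp (.not (.all 1 (.not (fLt 1 0)))) (tr ψ))

/-- The sentence. -/
def big (ψ : Fml L) : Fml (PL L) := fAnd ax1 (fAnd ax2 (ax3 ψ))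

theorem eval_big (ψ : Fml L) (va : ℕ → N) (vs) (vr) : Eval (big ψ) va vs vr ↔
    (∀ x y : N, x ≠ y → ¬ LTrel (L := L) N x y → LTrel (L := L) N y x) ∧
    (∀ p x y : N, LTrel (L := L) N x p → LTrel (L := L) N y p →
      rr (L := L) N p (gg (L := L) N p x) = rr (L := L) N p (gg (L := L) N p y) → x = y) ∧
    (∀ p : N, (∃ x, LTrel (L := L) N x p) → Eval (tr ψ) (Function.update va 0 p) vs vr) := by
  simp only [big, ax1, ax2, ax3, eval_fAnd, eval_fImp, Eval, eval_fLt, realize_tR, realize_tG, rr, gg]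
  simp [Function.update]

theorem fv_fAnd (a b : Fml L) : fv (fAnd a b) = fv a ∪ fv b := by
  ext x; simp [fAnd, fv, or_comm]
theorem sv_fAnd (a b : Fml L) : sv (fAnd a b) = sv a ∪ sv b := by
  ext x; simp [fAnd, sv, or_comm]
theorem rv_fAnd (a b : Fml L) : rv (fAnd a b) = rv a ∪ rv b := by
  ext x; simp [fAnd, rv, or_comm]
theorem ok_fAnd (a b : Fml L) : Ok LII (fAnd a b) ↔ Ok LII a ∧ Ok LII b := by
  simp [fAnd, Ok, LII, and_comm]
theorem fv_fImp (a b : Fml L) : fv (fImp a b) = fv a ∪ fv b := by simp [fImp, fv, fv_fAnd]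
theorem sv_fImp (a b : Fml L) : sv (fImp a b) = sv a ∪ sv b := by simp [fImp, sv, sv_fAnd]
theorem rv_fImp (a b : Fml L) : rv (fImp a b) = rv a ∪ rv b := by simp [fImp, rv, rv_fAnd]
theorem ok_fImp (a b : Fml L) : Ok LII (fImp a b) ↔ Ok LII a ∧ Ok LII b := by
  simp [fImp, Ok, ok_fAnd]
theorem fv_fLt (x y : ℕ) : fv (fLt (L := L) x y) = {x, y} := by
  ext z; simp [fLt, fv, tvars, Fin.exists_fin_two]

theorem big_sentence (ψ : Fml L) (h : IsSentence ψ) : IsSentence (big ψ) := by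
  obtain ⟨h1, h2, h3⟩ := h
  refine ⟨?_, ?_, ?_⟩
  · have : fv (tr ψ) ⊆ {0} := by
      rintro (_ | x) hx
      · rfl
      · have := fv_tr ψ x hx; simp [h1] at this
    ext z
    have hz : z ∈ fv (tr ψ) → z = 0 := fun h => this h
    simp [big, ax1, ax2, ax3, fv_fAnd, fv_fImp, fv_fLt, fv, tvars, tvars_tR, tvars_tG]
    grind
  · simp [big, ax1, ax2, ax3, sv_fAnd, sv_fImp, fLt, sv, sv_tr, h2]
  · simp [big, ax1, ax2, ax3, rv_fAnd, rv_fImp, fLt, rv, rv_tr, h3]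

theorem big_ok (ψ : Fml L) (h : Ok LII ψ) : Ok LII (big ψ) := by
  simp [big, ax1, ax2, ax3, ok_fAnd, ok_fImp, fLt, Ok, ok_tr, h]

/-- The structure on the range of `r(p, ·)`. -/
def sliceStr (N : Type) [(PL L).Structure N] (p : N) :
    L.Structure (Set.range (rr (L := L) N p)) where
  funMap {n} f xs := Set.rangeFactorization (rr (L := L) N p)
    (Language.Structure.funMap (L := PL L) (n := n+1) (PF.lift f : PF L (n+1))
      (Fin.cons p (Subtype.val ∘ xs) : Fin (n+1) → N))
  RelMap {n} R xs := Language.Structure.RelMap (L := PL L) (n := n+1) (PR.lift R : PR L (n+1))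
      (Fin.cons p (Subtype.val ∘ xs) : Fin (n+1) → N)

theorem slice_sliceStr (N : Type) [(PL L).Structure N] (p : N) :
    letI := sliceStr (L := L) N p
    Slice (L := L) N (Set.range (rr (L := L) N p)) p
      (Set.rangeFactorization (rr (L := L) N p)) Subtype.val :=
  letI := sliceStr (L := L) N p
  { surj := Set.rangeFactorization_surjective
    inj := Subtype.val_injective
    r := fun _ => rfl
    fn := fun _ _ => rfl
    rl := fun _ _ => Iff.rfl }

theorem slice_sat (h : Slice (L := L) N M p ρ e) (ψ : Fml L) (hok : Ok LII ψ)
    (H : ∀ (va : ℕ → N) (vs : ℕ → Set N) (vr : ℕ → N → N → Prop),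
      Eval (tr ψ) (Function.update va 0 p) vs vr) : Sat M ψ := by
  intro va vs vr
  choose s hs using h.surj
  have := H (fun i => s (va (i-1))) (fun X => Set.image e (vs X))
    (fun R a b => ∃ c d, e c = a ∧ e d = b ∧ vr R c d)
  rw [eval_tr h ψ hok _ _ _ (by simp)] at this
  convert this using 1
  · funext i; simp [hs]
  · funext X; simp [Set.preimage_image_eq _ h.inj]
  · funext R a b
    refine propext ⟨fun hab => ⟨a, b, rfl, rfl, hab⟩, ?_⟩
    rintro ⟨c, d, hc, hd, hcd⟩
    rwa [h.inj hc, h.inj hd] at hcd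

theorem card_bound {N : Type} (lt : N → N → Prop) (κ : Cardinal.{0}) (hκ : ℵ₀ ≤ κ)
    (tot : ∀ x y, x ≠ y → ¬ lt x y → lt y x) (hp : ∀ p, #{x | lt x p} ≤ κ) :
    #N ≤ Order.succ κ := by
  by_contra! hc
  obtain ⟨A, hA⟩ := Cardinal.le_mk_iff_exists_set.1 hc.le
  by_cases hb : ∃ x, ∀ a ∈ A, a = x ∨ lt a x
  · obtain ⟨x, hx⟩ := hb
    have h1 : A ⊆ insert x {a | lt a x} := fun a ha => hx a ha
    have h2 : #A ≤ κ := (Cardinal.mk_le_mk_of_subset h1).trans <| (Cardinal.mk_insert_le).trans <|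
      (add_le_add_left (hp x) 1).trans (Cardinal.add_one_eq hκ).le
    rw [hA] at h2
    exact absurd h2 (not_le.2 (Order.lt_succ κ))
  · push Not at hb
    have h1 : (Set.univ : Set N) ⊆ ⋃ a : A, {x | lt x a} := by
      intro x _
      obtain ⟨a, ha, hne, hl⟩ := hb x
      exact Set.mem_iUnion.2 ⟨⟨a, ha⟩, tot a x hne hl⟩
    have h2 : #N ≤ Order.succ κ := by
      rw [← Cardinal.mk_univ]
      refine (Cardinal.mk_le_mk_of_subset h1).trans ?_
      refine (Cardinal.mk_iUnion_le _).trans ?_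
      rw [hA]
      refine (mul_le_mul_right (ciSup_le' fun a : A => (hp a).trans (Order.le_succ κ)) _).trans ?_
      exact (Cardinal.mul_eq_self (hκ.trans (Order.le_succ κ))).le
    exact absurd h2 (not_le.2 hc)

theorem big_bdd (ψ : Fml L) (hok : Ok LII ψ) (h : BddSpec ψ) : BddSpec (big ψ) := by
  obtain ⟨κ, hκ⟩ := h
  refine ⟨Order.succ (Order.succ (max κ ℵ₀)), fun N S hN => ?_⟩
  rw [Order.lt_succ_iff]
  rcases isEmpty_or_nonempty N with hE | ⟨⟨n0⟩⟩
  · simp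
  have H := fun va vs vr => (eval_big ψ va vs vr).1 (hN va vs vr)
  have H0 := H (fun _ => n0) (fun _ => ∅) (fun _ _ _ => True)
  refine card_bound (LTrel (L := L) N) _ (le_max_right _ _) H0.1 fun p => ?_
  by_cases hp : ∃ x, LTrel (L := L) N x p
  · letI := sliceStr (L := L) N p
    have hs : Sat (Set.range (rr (L := L) N p)) ψ :=
      slice_sat (slice_sliceStr N p) ψ hok fun va vs vr => (H va vs vr).2.2 p hp
    refine le_trans ?_ ((hκ _ _ hs).le.trans (le_max_left _ _))
    refine Cardinal.mk_le_of_injective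
      (f := fun x => ⟨rr (L := L) N p (gg (L := L) N p x.1), Set.mem_range_self _⟩) ?_
    intro x y hxy
    exact Subtype.ext (H0.2.1 p x y x.2 y.2 (congrArg Subtype.val hxy))
  · have : {x | LTrel (L := L) N x p} = ∅ := by
      ext x; simpa using fun hx => hp ⟨x, hx⟩
    rw [this]; simp

/-- Structure assembled from slices. -/
def bigStr {N : Type} (lt : N → N → Prop) (Mp : N → Type) (S : ∀ p, L.Structure (Mp p))
    (ρ : ∀ p, N → Mp p) (e : ∀ p, Mp p → N) (g : N → N → N) : (PL L).Structure N where
  funMap {n} f := match n, f with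
    | _, .lift f => fun xs => e (xs 0) ((S (xs 0)).funMap f fun i => ρ (xs 0) (xs i.succ))
    | _, .r => fun xs => e (xs 0) (ρ (xs 0) (xs 1))
    | _, .g => fun xs => g (xs 0) (xs 1)
  RelMap {n} R := match n, R with
    | _, .lift R => fun xs => (S (xs 0)).RelMap R fun i => ρ (xs 0) (xs i.succ)
    | _, .lt => fun xs => lt (xs 0) (xs 1)

theorem slice_bigStr {N : Type} (lt : N → N → Prop) (Mp : N → Type) (S : ∀ p, L.Structure (Mp p))
    (ρ : ∀ p, N → Mp p) (e : ∀ p, Mp p → N) (g : N → N → N) (hρ : ∀ p m, ρ p (e p m) = m) (p : N) :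
    letI := bigStr lt Mp S ρ e g
    Slice (L := L) N (Mp p) p (ρ p) (e p) :=
  letI := bigStr lt Mp S ρ e g
  { surj := fun m => ⟨_, hρ p m⟩
    inj := Function.LeftInverse.injective (hρ p)
    r := fun _ => rfl
    fn := fun {n} f xs => by
      have : (fun i => ρ p ((Fin.cons p (e p ∘ xs) : Fin (n+1) → N) i.succ)) = xs := by
        funext i; simp [hρ]
      show (S p).funMap f xs = ρ p (e p ((S p).funMap f
        (fun i => ρ p ((Fin.cons p (e p ∘ xs) : Fin (n+1) → N) i.succ))))
      rw [hρ, this]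
    rl := fun {n} f xs => by
      have : (fun i => ρ p ((Fin.cons p (e p ∘ xs) : Fin (n+1) → N) i.succ)) = xs := by
        funext i; simp [hρ]
      show (S p).RelMap f xs ↔ (S p).RelMap f
        (fun i => ρ p ((Fin.cons p (e p ∘ xs) : Fin (n+1) → N) i.succ))
      rw [this] }

theorem bddAbove_spec (φ : Fml L) (h : BddSpec φ) :
    BddAbove {c | ∃ (M : Type) (S : L.Structure M), @Sat L M S φ ∧ c = Order.succ #M} := by
  obtain ⟨κ, hκ⟩ := h
  refine ⟨κ, ?_⟩
  rintro c ⟨M, S, hM, rfl⟩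
  exact Order.succ_le_of_lt (hκ M S hM)

theorem big_model (ψ : Fml L) (hok : Ok LII ψ) (h : BddSpec ψ) :
    ∃ (N : Type) (S : (PL L).Structure N), @Sat (PL L) N S (big ψ) ∧ #N = hanfVal ψ := by
  set c := hanfVal ψ with hc
  let N := c.ord.ToType
  have hN : #N = c := by simp [N]
  have key : ∀ p : N, ∃ (M : Type) (S : L.Structure M) (ρ : N → M) (e : M → N) (g : N → N),
      (∀ m, ρ (e m) = m) ∧ ((∃ x, x < p) →
        Sat M ψ ∧ ∀ x y, x < p → y < p → ρ (g x) = ρ (g y) → x = y) := by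
    intro p
    by_cases hp : ∃ x, x < p
    · have h1 : #(Set.Iio p) < c := Cardinal.mk_Iio_toType_ord_lt p
      have hset : {c | ∃ (M : Type) (S : L.Structure M), @Sat L M S ψ ∧
          c = Order.succ #M}.Nonempty := by
        by_contra hne
        rw [Set.not_nonempty_iff_eq_empty] at hne
        have : c = 0 := by rw [hc, hanfVal, hne]; simp
        rw [this] at hN
        exact (Cardinal.mk_eq_zero_iff.1 hN).false p
      obtain ⟨_, ⟨M, S, hM, rfl⟩, hlt⟩ := exists_lt_of_lt_csSup hset (h1.trans_eq hc)
      rw [Order.lt_succ_iff] at hlt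
      have hMc : #M ≤ #N := by
        rw [hN, hc]
        exact (Order.le_succ _).trans (le_csSup (bddAbove_spec ψ h) ⟨M, S, hM, rfl⟩)
      obtain ⟨j⟩ := hlt
      obtain ⟨e⟩ := hMc
      obtain ⟨x0, hx0⟩ := hp
      haveI : Nonempty M := ⟨j ⟨x0, hx0⟩⟩
      classical
      refine ⟨M, S, Function.invFun e, e, fun x => if hx : x < p then e (j ⟨x, hx⟩) else x,
        Function.leftInverse_invFun e.injective, fun _ => ⟨hM, ?_⟩⟩
      intro x y hx hy hxy
      simp only [hx, hy, dif_pos, Function.leftInverse_invFun e.injective _] at hxy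
      exact congrArg Subtype.val (j.injective hxy)
    · exact ⟨N, ⟨fun _ _ => p, fun _ _ => True⟩, id, id, id, fun _ => rfl, fun h => (hp h).elim⟩
  choose Mp S ρ e g hρ hx using key
  letI str := bigStr (· < ·) Mp S ρ e g
  refine ⟨N, str, ?_, hN⟩
  intro va vs vr
  rw [eval_big]
  refine ⟨?_, ?_, ?_⟩
  · intro x y hne hl
    exact lt_of_le_of_ne (not_lt.1 hl) hne.symm
  · intro p x y hxp hyp hxy
    exact (hx p ⟨x, hxp⟩).2 x y hxp hyp (Function.LeftInverse.injective (hρ p) hxy)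
  · intro p hp
    rw [eval_tr (slice_bigStr (· < ·) Mp S ρ e g hρ p) ψ hok _ _ _ (by simp)]
    exact (hx p hp).1 _ _ _

end

/-- For every second-order sentence `ψ` with `h(ψ) < ∞` there exists a second-order
sentence `φ` with `h(ψ) < h(φ) < ∞`. -/
theorem hanfVal_II_cofinal :
    ∀ (L : FirstOrder.Language.{0,0}) (ψ : Fml L),
      IsSentence ψ → Ok LII ψ → BddSpec ψ →
      ∃ (L' : FirstOrder.Language.{0,0}) (φ : Fml L'),
        IsSentence φ ∧ Ok LII φ ∧ BddSpec φ ∧ hanfVal ψ < hanfVal φ := by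
  intro L ψ hs hok hb
  refine ⟨PL L, big ψ, big_sentence ψ hs, big_ok ψ hok, big_bdd ψ hok hb, ?_⟩
  obtain ⟨N, S, hN, hc⟩ := big_model ψ hok hb
  rw [← hc]
  exact (Order.lt_succ _).trans_le
    (le_csSup (bddAbove_spec _ (big_bdd ψ hok hb)) ⟨N, S, hN, rfl⟩)

end Hanf
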